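/- Let n ≥ 1 and for each index p in a finite nonempty set P let α_{p,1},…,α_{p,n} be nonzero integers, and J(p) an integer. For p ∈ P set A_p = {i : α_{p,i} > 0}, B_p = {k : α_{p,k} < 0}, σ(p) = (−1)^{#B_p}, and for l ∈ ℤ let N_p(l) be the number of tuples (m_i)_{i∈A_p} ∈ ℕ₊^{A_p}, (n_k)_{k∈B_p} ∈ ℕ^{B_p} with J(p) + ∑_{i∈A_p} m_i α_{p,i} − ∑_{k∈B_p} n_k α_{p,k} = l. Suppose the function χ(z) = ∑_{p∈P} z^{J(p)}/∏_{j=1}^n (1 − z^{−α_{p,j}}) extends to a Laurent polynomial on 0 < |z| < 1. Then for all sufficiently large natural numbers l, ∑_{p: σ(p)=1} N_p(l) = ∑_{p: σ(p)=−1} N_p(l). -/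

import Mathlib

/-- Partition function `N_p(l)`: counting tuples `(m_i)_{i∈A_p} ∈ ℕ₊`,
`(n_k)_{k∈B_p} ∈ ℕ` with `J p + ∑_{A_p} m_i α_{p i} − ∑_{B_p} n_k α_{p k} = l`;
encoded by `f : Fin n → ℕ` with `f i ≥ 1` when `α p i > 0`, via
`J p + ∑ i, f i * |α p i| = l`. -/
noncomputable def Npart {ι : Type*} (n : ℕ) (α : ι → Fin n → ℤ) (J : ι → ℤ)
    (p : ι) (l : ℤ) : ℕ :=
  Nat.card {f : Fin n → ℕ //
    (∀ i, 0 < α p i → 0 < f i) ∧ J p + ∑ i, (f i : ℤ) * |α p i| = l}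

lemma aux_inf : Set.Infinite {z : ℂ | 0 < ‖z‖ ∧ ‖z‖ < 1} := by
  refine Set.infinite_of_injective_forall_mem (f := fun k : ℕ => (((k : ℝ) + 2)⁻¹ : ℝ) |> fun x => (x : ℂ)) ?_ ?_
  · intro a b h
    simpa using h
  · intro k
    have h : (0 : ℝ) < (k : ℝ) + 2 := by positivity
    simp only [Set.mem_ofPred_eq, Complex.norm_real, Real.norm_eq_abs]
    rw [abs_of_pos (inv_pos.mpr h)]
    refine ⟨inv_pos.mpr h, inv_lt_one_of_one_lt₀ ?_⟩
    linarith [(Nat.cast_nonneg k : (0:ℝ) ≤ k)]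

/-- geometric series in `X ^ a`, starting at exponent `0` or `a` -/
noncomputable def auxG (α : ℤ) : PowerSeries ℂ :=
  PowerSeries.mk fun k => if α.natAbs ∣ k ∧ (0 < α → 0 < k) then 1 else 0

/-- numerator exponent -/
def auxE (α : ℤ) : ℕ := if 0 < α then α.natAbs else 0

lemma auxG_coeff (hp : Prop) [Decidable hp] (a k : ℕ) (ha : 0 < a) :
    ((if a ∣ k ∧ (hp → 0 < k) then (1 : ℂ) else 0) -
      if a ≤ k then if a ∣ k - a ∧ (hp → 0 < k - a) then 1 else 0 else 0) =
    if k = if hp then a else 0 then 1 else 0 := by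
  have hd : a ≤ k → (a ∣ k - a ↔ a ∣ k) := fun h => by
    rw [Nat.dvd_sub_iff_left h dvd_rfl]
  rcases lt_trichotomy k a with hk | hk | hk
  · have h0 : a ∣ k ↔ k = 0 := ⟨fun h => Nat.eq_zero_of_dvd_of_lt h hk, fun h => by simp [h]⟩
    simp only [h0]
    rw [if_neg (show ¬ a ≤ k by omega), sub_zero]
    by_cases h : hp
    · simp only [h, if_true, true_imp_iff]
      rw [if_neg (by omega), if_neg (by omega)]
    · simp [h]
  · subst hk
    by_cases h : hp <;> simp [h, ha, ha.ne']
  · have h1 : 0 < k := by omega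
    have h2 : 0 < k - a := by omega
    simp only [hd hk.le, h1, h2, hk.le, if_true, imp_true_iff, and_true, sub_self]
    rw [if_neg]
    split_ifs <;> omega

lemma auxG_mul (α : ℤ) (h : α ≠ 0) :
    auxG α * (1 - PowerSeries.X ^ α.natAbs) = PowerSeries.X ^ auxE α := by
  have ha : 0 < α.natAbs := Int.natAbs_pos.mpr h
  ext k
  rw [mul_sub, mul_one, map_sub, PowerSeries.coeff_mul_X_pow', PowerSeries.coeff_X_pow]
  simp only [auxG, PowerSeries.coeff_mk, auxE]
  exact auxG_coeff (0 < α) _ k ha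

lemma aux_coeff (n : ℕ) (a : Fin n → ℤ) (h : ∀ j, a j ≠ 0) (d : ℕ) :
    PowerSeries.coeff d (∏ j, auxG (a j)) =
      (Nat.card {f : Fin n → ℕ // (∀ i, 0 < a i → 0 < f i) ∧
        ∑ i, (f i : ℤ) * |a i| = d} : ℂ) := by
  classical
  rw [PowerSeries.coeff_prod]
  simp only [auxG, PowerSeries.coeff_mk]
  have : ∀ l : Fin n →₀ ℕ, (∏ j, if (a j).natAbs ∣ l j ∧ (0 < a j → 0 < l j) then (1:ℂ) else 0)
      = if ∀ j, (a j).natAbs ∣ l j ∧ (0 < a j → 0 < l j) then 1 else 0 := by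
    intro l
    split_ifs with hl
    · exact Finset.prod_eq_one fun j _ => if_pos (hl j)
    · push Not at hl
      obtain ⟨j, hj⟩ := hl
      refine Finset.prod_eq_zero (Finset.mem_univ j) (if_neg ?_)
      rintro ⟨h1, h2⟩
      have := hj h1
      omega
  simp only [this]
  rw [Finset.sum_boole]
  congr 1
  rw [← Fintype.card_coe, ← Nat.card_eq_fintype_card]
  symm
  have hcast : ∀ f : Fin n → ℕ, (∑ i, (f i : ℤ) * |a i| = d) ↔ ∑ i, f i * (a i).natAbs = d := by
    intro f
    rw [← Nat.cast_inj (R := ℤ)]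
    push_cast
    rfl
  refine Nat.card_eq_of_bijective (fun f => ⟨Finsupp.equivFunOnFinite.symm
    (fun i => f.1 i * (a i).natAbs), ?_⟩) ⟨?_, ?_⟩
  · rw [Finset.mem_filter, Finset.mem_finsuppAntidiag]
    refine ⟨⟨?_, Finset.subset_univ _⟩, fun j => ⟨?_, fun hj => ?_⟩⟩
    · simpa using (hcast f.1).1 f.2.2
    · simp
    · simpa using ⟨f.2.1 j hj, h j⟩
  · intro f g hfg
    have h1 := Finsupp.equivFunOnFinite.symm.injective (Subtype.mk.inj hfg)
    ext i
    have h2 := congrFun h1 i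
    exact Nat.eq_of_mul_eq_mul_right (Int.natAbs_pos.mpr (h i)) h2
  · rintro ⟨l, hl⟩
    rw [Finset.mem_filter, Finset.mem_finsuppAntidiag] at hl
    obtain ⟨⟨hs, -⟩, hl⟩ := hl
    have hdiv : ∀ i, l i / (a i).natAbs * (a i).natAbs = l i := fun i =>
      Nat.div_mul_cancel (hl i).1
    refine ⟨⟨fun i => l i / (a i).natAbs, ?_, ?_⟩, ?_⟩
    · intro i hi
      exact Nat.div_pos (Nat.le_of_dvd ((hl i).2 hi) (hl i).1) (Int.natAbs_pos.mpr (h i))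
    · rw [hcast]
      simpa only [hdiv] using hs
    · ext i
      simpa using hdiv i

/-- sign -/
def auxC (α : ℤ) : ℂ := if 0 < α then -1 else 1

lemma aux_factor (α : ℤ) (h : α ≠ 0) (z : ℂ) (h0 : 0 < ‖z‖) (h1 : ‖z‖ < 1) :
    1 - z ^ α.natAbs ≠ 0 ∧
    (1 - z ^ (-α))⁻¹ = auxC α * z ^ auxE α / (1 - z ^ α.natAbs) := by
  have ha : α.natAbs ≠ 0 := Int.natAbs_ne_zero.mpr h
  have hz : z ≠ 0 := norm_pos_iff.mp h0
  have hne : 1 - z ^ α.natAbs ≠ 0 := by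
    intro h2
    have h3 : z ^ α.natAbs = 1 := by linear_combination -h2
    have h4 := congrArg norm h3
    rw [norm_pow, norm_one] at h4
    exact absurd h4 (pow_lt_one₀ h0.le h1 ha).ne
  refine ⟨hne, ?_⟩
  unfold auxC auxE
  by_cases hp : 0 < α
  · simp only [hp, if_true]
    obtain ⟨m, rfl⟩ := Int.eq_ofNat_of_zero_le hp.le
    simp only [zpow_neg, zpow_natCast, Int.natAbs_natCast] at hne ⊢
    have hm : z ^ m ≠ 0 := pow_ne_zero _ hz
    have h5 : 1 - (z ^ m)⁻¹ = -(1 - z ^ m) / z ^ m := by field_simp; ring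
    rw [h5, inv_div, div_neg]
    ring
  · simp only [hp, if_false]
    obtain ⟨m, hm⟩ := Int.eq_ofNat_of_zero_le (a := -α) (by omega)
    have : α.natAbs = m := by omega
    rw [hm, this, zpow_natCast]
    simp

lemma aux_sign (n : ℕ) (a : Fin n → ℤ) (h : ∀ j, a j ≠ 0) :
    ∏ j, auxC (a j) = (-1) ^ n *
      (if Even (Finset.univ.filter fun i => a i < 0).card then 1 else -1) := by
  have h1 : ∀ j, auxC (a j) = (-1) * (if a j < 0 then -1 else 1) := by
    intro j
    unfold auxC
    rcases lt_or_gt_of_ne (h j) with h2 | h2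
    · simp [h2, h2.le, not_lt.mpr h2.le]
    · simp [h2, not_lt.mpr h2.le]
  simp only [h1]
  rw [Finset.prod_mul_distrib, Finset.prod_const, Finset.card_univ, Fintype.card_fin,
    Finset.prod_ite, Finset.prod_const, Finset.prod_const_one, mul_one]
  congr 1
  split_ifs with h2
  · exact h2.neg_one_pow
  · exact (Nat.not_even_iff_odd.mp h2).neg_one_pow

/-- denominator -/
noncomputable def auxD {n : ℕ} (a : Fin n → ℤ) : Polynomial ℂ :=
  ∏ j, (1 - Polynomial.X ^ (a j).natAbs)

lemma auxD_mul {n : ℕ} (a : Fin n → ℤ) (h : ∀ j, a j ≠ 0) :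
    (∏ j, auxG (a j)) * (auxD a : PowerSeries ℂ) = PowerSeries.X ^ (∑ j, auxE (a j)) := by
  have : (auxD a : PowerSeries ℂ) = ∏ j, (1 - PowerSeries.X ^ (a j).natAbs) := by
    unfold auxD
    rw [← Polynomial.coeToPowerSeries.ringHom_apply, map_prod]
    simp
  rw [this, ← Finset.prod_mul_distrib, ← Finset.prod_pow_eq_pow_sum]
  exact Finset.prod_congr rfl fun j _ => auxG_mul _ (h j)

lemma aux_term {n : ℕ} (a : Fin n → ℤ) (h : ∀ j, a j ≠ 0) (z : ℂ) (h0 : 0 < ‖z‖) (h1 : ‖z‖ < 1) :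
    (auxD a).eval z ≠ 0 ∧
    (∏ j, (1 - z ^ (-a j)))⁻¹ =
      (∏ j, auxC (a j)) * z ^ (∑ j, auxE (a j)) / (auxD a).eval z := by
  have he : (auxD a).eval z = ∏ j, (1 - z ^ (a j).natAbs) := by
    simp [auxD, Polynomial.eval_prod]
  rw [he]
  refine ⟨Finset.prod_ne_zero_iff.mpr fun j _ => (aux_factor _ (h j) z h0 h1).1, ?_⟩
  rw [← Finset.prod_inv_distrib, ← Finset.prod_pow_eq_pow_sum, ← Finset.prod_mul_distrib,
    ← Finset.prod_div_distrib]
  exact Finset.prod_congr rfl fun j _ => (aux_factor _ (h j) z h0 h1).2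

lemma aux_bound (T : Finset ℤ) : ∃ K : ℕ, ∀ x ∈ T, -(K : ℤ) ≤ x ∧ x ≤ K := by
  refine ⟨∑ x ∈ T, x.natAbs, fun x hx => ?_⟩
  have := Finset.single_le_sum (f := fun x : ℤ => x.natAbs) (fun _ _ => Nat.zero_le _) hx
  omega

theorem stmt_7 {ι : Type*} (n : ℕ) (hn : 1 ≤ n) (P : Finset ι) (hP : P.Nonempty)
    (α : ι → Fin n → ℤ) (hα : ∀ p ∈ P, ∀ j, α p j ≠ 0) (J : ι → ℤ)
    (S : Finset ℤ) (E : ℤ → ℂ)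
    (hχ : ∀ z : ℂ, 0 < ‖z‖ → ‖z‖ < 1 →
      ∑ p ∈ P, z ^ J p / ∏ j, (1 - z ^ (-α p j)) = ∑ ρ ∈ S, E ρ * z ^ ρ) :
    ∃ L : ℕ, ∀ l : ℕ, L ≤ l →
      ∑ p ∈ P.filter (fun p => Even (Finset.univ.filter fun i => α p i < 0).card),
          Npart n α J p l =
      ∑ p ∈ P.filter (fun p => ¬ Even (Finset.univ.filter fun i => α p i < 0).card),
          Npart n α J p l := by
  classical
  obtain ⟨K, hK⟩ := aux_bound (S ∪ P.image J)
  have hKS : ∀ ρ ∈ S, -(K : ℤ) ≤ ρ ∧ ρ ≤ K := fun ρ h => hK ρ (Finset.mem_union_left _ h)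
  have hKJ : ∀ p ∈ P, -(K : ℤ) ≤ J p ∧ J p ≤ K := fun p h =>
    hK _ (Finset.mem_union_right _ (Finset.mem_image_of_mem _ h))
  set c : ι → ℂ := fun p => ∏ j, auxC (α p j) with hc
  set e : ι → ℕ := fun p => ∑ j, auxE (α p j) with he
  set k : ι → ℕ := fun p => (K + J p).toNat with hk
  set Q : Polynomial ℂ := ∑ ρ ∈ S, Polynomial.C (E ρ) * Polynomial.X ^ (K + ρ).toNat with hQ
  have hzp : ∀ z : ℂ, z ≠ 0 → ∀ x : ℤ, -(K : ℤ) ≤ x → z ^ K * z ^ x = z ^ (K + x).toNat := by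
    intro z hz x hx
    rw [← zpow_natCast, ← zpow_natCast, ← zpow_add₀ hz, Int.toNat_of_nonneg (by omega)]
  -- polynomial identity
  have hpoly : ∑ p ∈ P, Polynomial.C (c p) * Polynomial.X ^ (k p + e p) *
      ∏ q ∈ P.erase p, auxD (α q) = Q * ∏ q ∈ P, auxD (α q) := by
    refine Polynomial.eq_of_infinite_eval_eq _ _ (aux_inf.mono ?_)
    rintro z ⟨h0, h1⟩
    have hz : z ≠ 0 := norm_pos_iff.mp h0
    simp only [Set.mem_ofPred_eq]
    have hQe : Q.eval z = z ^ K * ∑ ρ ∈ S, E ρ * z ^ ρ := by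
      rw [hQ, Polynomial.eval_finsetSum, Finset.mul_sum]
      refine Finset.sum_congr rfl fun ρ hρ => ?_
      simp only [Polynomial.eval_mul, Polynomial.eval_C, Polynomial.eval_pow, Polynomial.eval_X]
      rw [← hzp z hz ρ (hKS ρ hρ).1]
      ring
    rw [Polynomial.eval_mul, hQe, ← hχ z h0 h1, Polynomial.eval_finsetSum, Finset.mul_sum,
      Finset.sum_mul]
    refine Finset.sum_congr rfl fun p hp => ?_
    obtain ⟨hD, ht⟩ := aux_term (α p) (hα p hp) z h0 h1
    rw [← Finset.mul_prod_erase P _ hp, div_eq_mul_inv, ht]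
    simp only [Polynomial.eval_mul, Polynomial.eval_C, Polynomial.eval_pow, Polynomial.eval_X]
    rw [pow_add, hk, ← hzp z hz (J p) (hKJ p hp).1]
    field_simp
    simp only [hc, he]
    ring
  -- power series identity
  have hps : ∑ p ∈ P, PowerSeries.C (c p) * (PowerSeries.X ^ k p * ∏ j, auxG (α p j)) =
      (Q : PowerSeries ℂ) := by
    have hD0 : ((∏ q ∈ P, auxD (α q) : Polynomial ℂ) : PowerSeries ℂ) ≠ 0 := by
      rw [Ne, Polynomial.coe_eq_zero_iff, Finset.prod_eq_zero_iff]
      rintro ⟨q, hq, h⟩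
      have := (aux_term (α q) (hα q hq) (1/2) (by norm_num) (by norm_num)).1
      rw [h] at this
      simp at this
    refine mul_right_cancel₀ hD0 ?_
    rw [← Polynomial.coe_mul, ← hpoly, Finset.sum_mul, ← Polynomial.coeToPowerSeries.ringHom_apply,
      ← Polynomial.coeToPowerSeries.ringHom_apply, map_sum]
    refine Finset.sum_congr rfl fun p hp => ?_
    rw [← Finset.mul_prod_erase P _ hp]
    simp only [map_mul, Polynomial.coeToPowerSeries.ringHom_apply, Polynomial.coe_C,
      Polynomial.coe_pow, Polynomial.coe_X, pow_add]
    have := auxD_mul (α p) (hα p hp)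
    simp only [he]
    rw [← this]
    ring
  refine ⟨K + Q.natDegree + 1, fun l hl => ?_⟩
  have hco := congrArg (PowerSeries.coeff (K + l)) hps
  rw [Polynomial.coeff_coe, Polynomial.coeff_eq_zero_of_natDegree_lt (by omega), map_sum] at hco
  have hterm : ∀ p ∈ P, PowerSeries.coeff (K + l)
      (PowerSeries.C (c p) * (PowerSeries.X ^ k p * ∏ j, auxG (α p j))) =
      (-1) ^ n * ((if Even (Finset.univ.filter fun i => α p i < 0).card then 1 else -1) *
        (Npart n α J p l : ℂ)) := by
    intro p hp
    have hb := hKJ p hp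
    have hkl : k p ≤ K + l := by simp only [hk]; omega
    rw [PowerSeries.coeff_C_mul, PowerSeries.coeff_X_pow_mul', if_pos hkl,
      aux_coeff n (α p) (hα p hp), hc]
    simp only
    rw [aux_sign n (α p) (hα p hp), mul_assoc, Npart]
    have hd : ((K + l - k p : ℕ) : ℤ) = l - J p := by simp only [hk] at hkl ⊢; omega
    rw [hd]
    simp only [eq_sub_iff_add_eq']
  rw [Finset.sum_congr rfl hterm, ← Finset.mul_sum] at hco
  have hco2 := (mul_eq_zero.mp hco).resolve_left (pow_ne_zero _ (by norm_num))
  rw [← Finset.sum_filter_add_sum_filter_not P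
    (fun p => Even (Finset.univ.filter fun i => α p i < 0).card)] at hco2
  rw [Finset.sum_congr rfl (g := fun p => (Npart n α J p l : ℂ))
      (fun p hp => by rw [if_pos (Finset.mem_filter.mp hp).2, one_mul]),
    Finset.sum_congr (s₁ := P.filter (fun p => ¬ _)) rfl (g := fun p => -(Npart n α J p l : ℂ))
      (fun p hp => by rw [if_neg (Finset.mem_filter.mp hp).2, neg_one_mul]),
    Finset.sum_neg_distrib, ← sub_eq_add_neg, sub_eq_zero] at hco2
  exact_mod_cast hco2
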